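/- arXiv:2505.17960 — 2 statements merged into one kernel-verified Lean document; each statement's English description precedes it below -/
import Mathlib

section
/- Let E and U be non-principal ultrafilters on ℕ that are not isomorphic, i.e., there is no bijection f : ℕ → ℕ whose pushforward maps E to U. Let (k_i)_{i∈ℕ} be a strictly increasing sequence of natural numbers with k_0 = 0, determining the interval partition {[k_i, k_{i+1}) : i ∈ ℕ} of ℕ. If E and U are both Q-points, then there exist v ∈ E and u ∈ U such that for every i ≥ 1: if v ∩ [k_i, k_{i+1}) ≠ ∅, then u ∩ [k_{i-1}, k_i) = ∅ and u ∩ [k_i, k_{i+1}) = ∅ and u ∩ [k_{i+1}, k_{i+2}) = ∅. -/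
/-- An ultrafilter on ℕ is non-principal iff it contains no finite sets. -/
def NonPrincipal (E : Ultrafilter ℕ) : Prop :=
  ∀ s : Set ℕ, s.Finite → s ∉ E

/-- An ultrafilter `E` on ℕ is a Q-point iff for every interval partition
`{[k i, k (i+1)) : i ∈ ℕ}` of ℕ (given by a strictly increasing sequence `k`
with `k 0 = 0`), there is `x ∈ E` meeting each interval in at most one point. -/
def IsQPoint (E : Ultrafilter ℕ) : Prop :=
  ∀ k : ℕ → ℕ, StrictMono k → k 0 = 0 →
    ∃ x ∈ E, ∀ i : ℕ, (x ∩ Set.Ico (k i) (k (i + 1))).ncard ≤ 1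

/-- Ultrafilters `E` and `U` on ℕ are isomorphic iff some bijection of ℕ
pushes `E` forward to `U`. -/
def UltraIso (E U : Ultrafilter ℕ) : Prop :=
  ∃ f : ℕ → ℕ, Function.Bijective f ∧ Ultrafilter.map f E = U


theorem aux_idx (k : ℕ → ℕ) (hk : StrictMono k) (hk0 : k 0 = 0) :
    ∃ d : ℕ → ℕ, ∀ n, k (d n) ≤ n ∧ n < k (d n + 1) := by
  have h : ∀ n, ∃ i, k i ≤ n ∧ n < k (i + 1) := by
    intro n
    have hex : ∃ j, n < k j := ⟨n + 1, lt_of_lt_of_le (Nat.lt_succ_self n) hk.le_apply⟩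
    classical
    have h1 := Nat.find_spec hex
    have h2 : Nat.find hex ≠ 0 := by
      intro h0
      rw [h0, hk0] at h1
      omega
    obtain ⟨m, hm⟩ := Nat.exists_eq_succ_of_ne_zero h2
    have h3 := Nat.find_min hex (m := m) (by omega)
    rw [hm] at h1
    exact ⟨m, by omega, h1⟩
  choose d hd using h
  exact ⟨d, hd⟩

theorem aux_spread (E : Ultrafilter ℕ) (hQ : IsQPoint E) (k : ℕ → ℕ) (hk : StrictMono k)
    (hk0 : k 0 = 0) (d : ℕ → ℕ) (hd : ∀ n, k (d n) ≤ n ∧ n < k (d n + 1)) :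
    ∃ v ∈ E, ∀ a ∈ v, ∀ b ∈ v, d a ≤ d b → d b ≤ d a + 2 → a = b := by
  have key : ∀ c ≤ 2, ∃ x ∈ E, ∀ a ∈ x, ∀ b ∈ x, (d a + c) / 3 = (d b + c) / 3 → a = b := by
    intro c hc
    obtain ⟨x, hx, h⟩ := hQ (fun j => k (3 * j - c))
      (strictMono_nat_of_lt_succ fun j => hk (by omega)) (by simpa using hk0)
    refine ⟨x, hx, fun a ha b hb hab => ?_⟩
    have hmem : ∀ n, n ∈ Set.Ico (k (3 * ((d n + c) / 3) - c))
        (k (3 * ((d n + c) / 3 + 1) - c)) := by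
      intro n
      exact ⟨(hk.monotone (by omega)).trans (hd n).1,
        (hd n).2.trans_le (hk.monotone (by omega))⟩
    have h1 := h ((d a + c) / 3)
    rw [Set.ncard_le_one ((Set.finite_Ico _ _).inter_of_right _)] at h1
    exact h1 a ⟨ha, hmem a⟩ b ⟨hb, by rw [hab]; exact hmem b⟩
  obtain ⟨x, hx, h0⟩ := key 0 (by omega)
  obtain ⟨y, hy, h1⟩ := key 1 (by omega)
  obtain ⟨z, hz, h2⟩ := key 2 (by omega)
  refine ⟨x ∩ (y ∩ z), E.inter_mem hx (E.inter_mem hy hz), ?_⟩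
  rintro a ⟨ax, ay, az⟩ b ⟨bx, bY, bz⟩ hab hba
  have : (d a + 0) / 3 = (d b + 0) / 3 ∨ (d a + 1) / 3 = (d b + 1) / 3 ∨
      (d a + 2) / 3 = (d b + 2) / 3 := by omega
  rcases this with h | h | h
  · exact h0 a ax b bx h
  · exact h1 a ay b bY h
  · exact h2 a az b bz h

theorem aux_iso (E : Ultrafilter ℕ) (hE : NonPrincipal E) (f : ℕ → ℕ) (A : Set ℕ) (hA : A ∈ E)
    (hf : Set.InjOn f A) : UltraIso E (Ultrafilter.map f E) := by
  classical
  have hinf : A.Infinite := fun h => hE A h hA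
  let e := hinf.natEmbedding A
  let g : ℕ → ℕ := fun n => (e n : ℕ)
  have hg : Function.Injective g := fun a b h => e.injective (Subtype.ext h)
  have hgA : ∀ n, g n ∈ A := fun n => (e n).2
  let P := Set.range fun n => g (2 * n)
  let Q := Set.range fun n => g (2 * n + 1)
  have hP : P.Infinite := Set.infinite_range_of_injective fun a b h => by
    have := hg h
    omega
  have hQ : Q.Infinite := Set.infinite_range_of_injective fun a b h => by
    have := hg h
    omega
  have hPA : P ⊆ A := by rintro _ ⟨n, rfl⟩; exact hgA _
  have hQA : Q ⊆ A := by rintro _ ⟨n, rfl⟩; exact hgA _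
  have hPQ : Q ⊆ Pᶜ := by
    rintro _ ⟨n, rfl⟩ ⟨m, hm⟩
    have := hg hm
    omega
  obtain ⟨B, C, hB, hBA, hCA, hC, hBC⟩ :
      ∃ B C : Set ℕ, B ∈ E ∧ B ⊆ A ∧ C ⊆ A ∧ C.Infinite ∧ C ⊆ Bᶜ := by
    by_cases h : P ∈ E
    · exact ⟨P, Q, h, hPA, hQA, hQ, hPQ⟩
    · exact ⟨A ∩ Pᶜ, P, E.inter_mem hA (Ultrafilter.compl_mem_iff_notMem.2 h),
        Set.inter_subset_left, hPA, hP, fun x hx hx' => hx'.2 hx⟩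
  have i1 : Infinite ↥(Bᶜ) := (hC.mono hBC).to_subtype
  have i2 : Infinite ↥((f '' B)ᶜ) := by
    refine Set.Infinite.to_subtype ((hC.image (hf.mono hCA)).mono ?_)
    rintro _ ⟨c, hc, rfl⟩ ⟨b, hb, hbc⟩
    have := hf (hBA hb) (hCA hc) hbc
    exact hBC hc (this ▸ hb)
  obtain ⟨e2⟩ : Nonempty (↥(Bᶜ) ≃ ↥((f '' B)ᶜ)) := nonempty_equiv_of_countable
  let e1 := Equiv.Set.imageOfInjOn f B (hf.mono hBA)
  let F : ℕ ≃ ℕ := (Equiv.Set.sumCompl B).symm.trans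
    ((Equiv.sumCongr e1 e2).trans (Equiv.Set.sumCompl (f '' B)))
  have hF : ∀ b ∈ B, F b = f b := by
    intro b hb
    simp [F, Equiv.Set.sumCompl_symm_apply_of_mem hb, e1, Equiv.Set.imageOfInjOn]
  refine ⟨F, F.bijective, ?_⟩
  apply Ultrafilter.coe_injective
  rw [Ultrafilter.coe_map, Ultrafilter.coe_map]
  exact Filter.map_congr (Filter.mem_of_superset hB hF)

theorem qpoints_avoid_neighboring_intervals
    (E U : Ultrafilter ℕ)
    (hE : NonPrincipal E) (hU : NonPrincipal U)
    (hniso : ¬ UltraIso E U)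
    (k : ℕ → ℕ) (hk : StrictMono k) (hk0 : k 0 = 0)
    (hQE : IsQPoint E) (hQU : IsQPoint U) :
    ∃ v ∈ E, ∃ u ∈ U, ∀ i : ℕ, 1 ≤ i →
      (v ∩ Set.Ico (k i) (k (i + 1))).Nonempty →
        u ∩ Set.Ico (k (i - 1)) (k i) = ∅ ∧
        u ∩ Set.Ico (k i) (k (i + 1)) = ∅ ∧
        u ∩ Set.Ico (k (i + 1)) (k (i + 2)) = ∅ := by
  classical
  obtain ⟨d, hd⟩ := aux_idx k hk hk0
  have hd' : ∀ n i, n ∈ Set.Ico (k i) (k (i + 1)) → d n = i := by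
    rintro n i ⟨h1, h2⟩
    have h3 := hk.lt_iff_lt.1 (h1.trans_lt (hd n).2)
    have h4 := hk.lt_iff_lt.1 ((hd n).1.trans_lt h2)
    omega
  let R : ℕ → ℕ → Prop := fun a b => d a ≤ d b + 1 ∧ d b ≤ d a + 1
  by_cases hmain : ∃ v ∈ E, ∃ u ∈ U, ∀ a ∈ v, ∀ b ∈ u, ¬ R a b
  · obtain ⟨v, hv, u, hu, h⟩ := hmain
    refine ⟨v, hv, u, hu, ?_⟩
    rintro i hi ⟨a, hav, ha⟩
    have ha' := hd' a i ha
    refine ⟨?_, ?_, ?_⟩ <;> rw [Set.eq_empty_iff_forall_notMem] <;> rintro b ⟨hbu, hb⟩ <;>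
      refine h a hav b hbu ?_
    · have := hd' b (i - 1) (by rwa [Nat.sub_add_cancel hi])
      exact ⟨by omega, by omega⟩
    · have := hd' b i hb
      exact ⟨by omega, by omega⟩
    · have := hd' b (i + 1) hb
      exact ⟨by omega, by omega⟩
  exfalso
  push Not at hmain
  obtain ⟨v, hv, hvs⟩ := aux_spread E hQE k hk hk0 d hd
  obtain ⟨u, hu, hus⟩ := aux_spread U hQU k hk hk0 d hd
  let f : ℕ → ℕ := fun a => if h : ∃ b ∈ u, R a b then h.choose else 0
  have hf : ∀ a, (∃ b ∈ u, R a b) → f a ∈ u ∧ R a (f a) := by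
    intro a h
    simp only [f, dif_pos h]
    exact h.choose_spec
  have hfu : ∀ a, ∀ b ∈ u, R a b → f a = b := by
    intro a b hb hab
    obtain ⟨h1, h2, h3⟩ := hf a ⟨b, hb, hab⟩
    obtain ⟨h4, h5⟩ := hab
    rcases le_total (d (f a)) (d b) with h | h
    · exact hus _ h1 _ hb h (by omega)
    · exact (hus _ hb _ h1 h (by omega)).symm
  have hmap : Ultrafilter.map f E = U := by
    refine Ultrafilter.coe_le_coe.1 fun B hB => ?_
    by_contra hn
    have hn' : f ⁻¹' B ∉ E := hn
    obtain ⟨a, ⟨_, haB⟩, b, ⟨hbB, hbu⟩, hab⟩ := hmain (v ∩ (f ⁻¹' B)ᶜ)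
      (E.inter_mem hv (Ultrafilter.compl_mem_iff_notMem.2 hn')) (B ∩ u) (U.inter_mem hB hu)
    apply haB
    rw [Set.mem_preimage, hfu a b hbu hab]
    exact hbB
  have hA : v ∩ {a | ∃ b ∈ u, R a b} ∈ E := by
    refine E.inter_mem hv ?_
    by_contra hn
    obtain ⟨a, ha, b, hb, hab⟩ := hmain _ (Ultrafilter.compl_mem_iff_notMem.2 hn) u hu
    exact ha ⟨b, hb, hab⟩
  apply hniso
  rw [← hmap]
  refine aux_iso E hE f _ hA ?_
  rintro a ⟨hav, ha⟩ a' ⟨hav', ha'⟩ h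
  obtain ⟨_, h2, h3⟩ := hf a ha
  obtain ⟨_, h4, h5⟩ := hf a' ha'
  rw [h] at h2 h3
  rcases le_total (d a) (d a') with h | h
  · exact hvs _ hav _ hav' h (by omega)
  · exact (hvs _ hav' _ hav h (by omega)).symm
end

section
/- Let E and U be non-principal ultrafilters on ℕ that are not isomorphic, i.e., there is no bijection f : ℕ → ℕ whose pushforward maps E to U, and assume both are Q-points. Let (k_i)_{i∈ℕ} be a strictly increasing sequence with k_0 = 0, determining the interval partition {[k_i, k_{i+1}) : i ∈ ℕ} of ℕ. Then there exist v ∈ E and u ∈ U such that no interval of the partition meets both v and u; that is, for every i ∈ ℕ, if v ∩ [k_i, k_{i+1}) ≠ ∅ then u ∩ [k_i, k_{i+1}) = ∅. -/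
theorem aux_bij (E : Ultrafilter ℕ) (hE : NonPrincipal E) (f : ℕ → ℕ) (x : Set ℕ)
    (hx : x ∈ E) (hf : Set.InjOn f x) :
    ∃ g : ℕ ≃ ℕ, Ultrafilter.map g E = Ultrafilter.map f E := by
  have hinf : ∀ s ∈ E, s.Infinite := fun s hs hfin => hE s hfin hs
  have key : ∀ t u : Set ℕ, t ∪ u = x → Disjoint t u → u.Infinite → t ∈ E →
      ∃ g : ℕ ≃ ℕ, Ultrafilter.map g E = Ultrafilter.map f E := by
    intro t u htu hd hu ht
    have htx : t ⊆ x := htu ▸ Set.subset_union_left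
    have hux : u ⊆ x := htu ▸ Set.subset_union_right
    have h1 : (tᶜ).Infinite := hu.mono fun a ha hat => Set.disjoint_left.1 hd hat ha
    have h2 : ((f '' t)ᶜ).Infinite := by
      refine (hu.image (hf.mono hux)).mono ?_
      rintro _ ⟨a, ha, rfl⟩ ⟨b, hb, hab⟩
      have := hf (htx hb) (hux ha) hab
      subst this
      exact Set.disjoint_left.1 hd hb ha
    have := h1.to_subtype
    have := h2.to_subtype
    obtain ⟨e2⟩ : Nonempty ((tᶜ : Set ℕ) ≃ ((f '' t)ᶜ : Set ℕ)) :=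
      nonempty_equiv_of_countable
    classical
    let e1 := Equiv.Set.imageOfInjOn f t (hf.mono htx)
    let g : ℕ ≃ ℕ := (Equiv.Set.sumCompl t).symm.trans
      ((Equiv.sumCongr e1 e2).trans (Equiv.Set.sumCompl (f '' t)))
    have hg : ∀ a ∈ t, g a = f a := by
      intro a ha
      simp [g, Equiv.Set.sumCompl_symm_apply_of_mem ha, e1, Equiv.Set.imageOfInjOn]
    refine ⟨g, ?_⟩
    apply Ultrafilter.coe_injective
    rw [Ultrafilter.coe_map, Ultrafilter.coe_map]
    exact Filter.map_congr (Filter.mem_of_superset ht hg)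
  obtain ⟨t, u, htu, hd, hc⟩ := (hinf x hx).exists_union_disjoint_cardinal_eq_of_infinite
  have hiff : t.Infinite ↔ u.Infinite := by
    rw [← Set.infinite_coe_iff, ← Set.infinite_coe_iff, Cardinal.infinite_iff,
      Cardinal.infinite_iff, hc]
  rcases Ultrafilter.union_mem_iff.1 (htu ▸ hx : t ∪ u ∈ E) with h | h
  · exact key t u htu hd (hiff.1 (hinf t h)) h
  · exact key u t (by rw [Set.union_comm, htu]) hd.symm (hiff.2 (hinf u h)) h

theorem qpoints_meet_disjoint_intervals
    (E U : Ultrafilter ℕ)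
    (hE : NonPrincipal E) (hU : NonPrincipal U)
    (hniso : ¬ UltraIso E U)
    (hQE : IsQPoint E) (hQU : IsQPoint U)
    (k : ℕ → ℕ) (hk : StrictMono k) (hk0 : k 0 = 0) :
    ∃ v ∈ E, ∃ u ∈ U, ∀ i : ℕ,
      (v ∩ Set.Ico (k i) (k (i + 1))).Nonempty →
        u ∩ Set.Ico (k i) (k (i + 1)) = ∅ := by
  have hex : ∀ n, ∃ i, k i ≤ n ∧ n < k (i + 1) := by
    intro n
    induction n with
    | zero => exact ⟨0, by omega, by have := hk (Nat.zero_lt_one); simp only [zero_add]; omega⟩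
    | succ n ih =>
      obtain ⟨i, h1, h2⟩ := ih
      by_cases h : n + 1 < k (i + 1)
      · exact ⟨i, by omega, h⟩
      · have := hk (Nat.lt_succ_self (i + 1))
        exact ⟨i + 1, by omega, by simp only [Nat.succ_eq_add_one] at this; omega⟩
  choose p hp1 hp2 using hex
  have huniq : ∀ n i, n ∈ Set.Ico (k i) (k (i + 1)) → p n = i := by
    intro n i hn
    have h1 : p n < i + 1 := hk.lt_iff_lt.1 ((hp1 n).trans_lt hn.2)
    have h2 : i < p n + 1 := hk.lt_iff_lt.1 (hn.1.trans_lt (hp2 n))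
    omega
  have hinj : ∀ x : Set ℕ, (∀ i, (x ∩ Set.Ico (k i) (k (i + 1))).ncard ≤ 1) →
      Set.InjOn p x := by
    intro x hx a ha b hb hab
    have hfin : (x ∩ Set.Ico (k (p a)) (k (p a + 1))).Finite :=
      (Set.finite_Ico _ _).subset Set.inter_subset_right
    refine (Set.ncard_le_one hfin).1 (hx (p a)) a ⟨ha, hp1 a, hp2 a⟩ b ⟨hb, ?_, ?_⟩
    · rw [hab]; exact hp1 b
    · rw [hab]; exact hp2 b
  by_cases heq : Ultrafilter.map p E = Ultrafilter.map p U
  · exfalso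
    obtain ⟨x, hx, hx1⟩ := hQE k hk hk0
    obtain ⟨y, hy, hy1⟩ := hQU k hk hk0
    obtain ⟨g, hg⟩ := aux_bij E hE p x hx (hinj x hx1)
    obtain ⟨h, hh⟩ := aux_bij U hU p y hy (hinj y hy1)
    refine hniso ⟨g.trans h.symm, (g.trans h.symm).bijective, ?_⟩
    rw [Equiv.coe_trans, ← Ultrafilter.map_map, hg, heq, ← hh, Ultrafilter.map_map]
    simp
  · have : ∃ A, A ∈ Ultrafilter.map p E ∧ A ∉ Ultrafilter.map p U := by
      by_contra hcon
      push Not at hcon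
      exact heq (Ultrafilter.coe_le_coe.1 (fun A hA => hcon A hA : _)).symm
    obtain ⟨A, hA, hA'⟩ := this
    refine ⟨p ⁻¹' A, hA, p ⁻¹' Aᶜ, Ultrafilter.compl_mem_iff_notMem.2 hA', ?_⟩
    rintro i ⟨a, ha, hai⟩
    ext b
    simp only [Set.mem_inter_iff, Set.mem_empty_iff_false, iff_false, not_and]
    intro hb hbi
    apply hb
    rw [huniq b i hbi, ← huniq a i hai]
    exact ha
end
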